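/- Let m and N be integers with 1 ≤ m ≤ N, and let R̂ := Sym(X|𝔹)/H as in the preceding setting. Then there is a unique Sym(𝔹)-module homomorphism ζ : R̂ → Sym(𝔹) (the Sylvester operator) such that for all λ, μ ∈ Λ_{m,N−m}: ζ( S_λ(X) · S_μ(X−𝔹) ) = 1 if λ_j + μ_{m+1−j} = N−m for all j = 1,…,m, and ζ( S_λ(X) · S_μ(X−𝔹) ) = 0 otherwise. -/

import Mathlib

/-!
Statement 5: In the setting of Statement 3 (`1 ≤ m ≤ N`, `R̂ = Sym(X|𝔹)/H`), there is a
unique `Sym(𝔹)`-module homomorphism `ζ : R̂ → Sym(𝔹)` (the Sylvester operator) with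
`ζ(S_λ(X)·S_μ(X−𝔹)) = 1` if `λ_j + μ_{m+1−j} = N−m` for all `j`, and `= 0` otherwise,
for all `λ, μ ∈ Λ_{m,N−m}`.
-/

open MvPolynomial

set_option synthInstance.maxHeartbeats 1000000
set_option maxHeartbeats 2000000

/-- The `j`-th elementary symmetric polynomial in the variables of the finset `A`. -/
noncomputable def esymmF {σ : Type*} [DecidableEq σ] (A : Finset σ) (j : ℕ) :
    MvPolynomial σ ℂ :=
  ∑ s ∈ A.powersetCard j, ∏ i ∈ s, X i

/-- The `j`-th complete homogeneous symmetric polynomial in the variables of the finset `A`. -/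
noncomputable def hsymmF {σ : Type*} [DecidableEq σ] (A : Finset σ) (j : ℕ) :
    MvPolynomial σ ℂ :=
  ∑ m ∈ A.sym j, ((m : Multiset σ).map X).prod

/-- `h_k(X−Y) := Σ_{j=0}^{k} (−1)^j e_j(Y) h_{k−j}(X)`. -/
noncomputable def hdiff {σ : Type*} [DecidableEq σ] (A B : Finset σ) (k : ℕ) :
    MvPolynomial σ ℂ :=
  ∑ j ∈ Finset.range (k + 1), (-1 : MvPolynomial σ ℂ) ^ j * esymmF B j * hsymmF A (k - j)

/-- `h_n(X−Y)` for an integer index `n`, vanishing for `n < 0`. -/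
noncomputable def hdiffZ {σ : Type*} [DecidableEq σ] (A B : Finset σ) (n : ℤ) :
    MvPolynomial σ ℂ :=
  if 0 ≤ n then hdiff A B n.toNat else 0

/-- `S_λ(X−Y) := det( h_{λ_i−i+j}(X−Y) )`. -/
noncomputable def SchurDiff {σ : Type*} [DecidableEq σ] (A B : Finset σ) {m : ℕ}
    (lam : Fin m → ℕ) : MvPolynomial σ ℂ :=
  (Matrix.of fun i j : Fin m => hdiffZ A B ((lam i : ℤ) - (i : ℤ) + (j : ℤ))).det

/-- The ordinary Schur polynomial `S_λ(X) = S_λ(X − ∅)`. -/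
noncomputable def SchurP {σ : Type*} [DecidableEq σ] (A : Finset σ) {m : ℕ}
    (lam : Fin m → ℕ) : MvPolynomial σ ℂ :=
  SchurDiff A ∅ lam

variable (m N : ℕ)

/-- The ambient polynomial ring `ℂ[x_1,…,x_m,b_1,…,b_N]`. -/
abbrev PXB := MvPolynomial (Fin m ⊕ Fin N) ℂ

/-- The finset of `x`-variables. -/
noncomputable def XS : Finset (Fin m ⊕ Fin N) :=
  Finset.univ.image (Sum.inl : Fin m → Fin m ⊕ Fin N)

/-- The finset of `b`-variables. -/
noncomputable def BS : Finset (Fin m ⊕ Fin N) :=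
  Finset.univ.image (Sum.inr : Fin N → Fin m ⊕ Fin N)

/-- `Sym(X|𝔹)`: polynomials symmetric separately in the `x`-variables and in the
`b`-variables. -/
noncomputable def SymXB : Subalgebra ℂ (PXB m N) where
  carrier := {p | ∀ (e : Equiv.Perm (Fin m)) (g : Equiv.Perm (Fin N)),
      rename (Equiv.sumCongr e g) p = p}
  mul_mem' {a b} ha hb := fun e g => by rw [map_mul, ha e g, hb e g]
  add_mem' {a b} ha hb := fun e g => by rw [map_add, ha e g, hb e g]
  algebraMap_mem' r := fun e g => by rw [MvPolynomial.algebraMap_eq, rename_C]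

/-- `Sym(𝔹) ⊆ Sym(X|𝔹)`: the subalgebra of elements that are (symmetric) polynomials in the
`b`-variables only. -/
noncomputable def SymB : Subalgebra ℂ ↥(SymXB m N) where
  carrier := {p | ∃ q : MvPolynomial (Fin N) ℂ,
      (p : PXB m N) = rename (Sum.inr : Fin N → Fin m ⊕ Fin N) q}
  mul_mem' := by
    rintro a b ⟨qa, ha⟩ ⟨qb, hb⟩
    exact ⟨qa * qb, by rw [MulMemClass.coe_mul, ha, hb, map_mul]⟩
  add_mem' := by
    rintro a b ⟨qa, ha⟩ ⟨qb, hb⟩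
    exact ⟨qa + qb, by rw [AddMemClass.coe_add, ha, hb, map_add]⟩
  algebraMap_mem' r :=
    ⟨MvPolynomial.C r, by
      rw [rename_C]
      rfl⟩

/-- The ideal of `Sym(X|𝔹)` generated by `h_N(X−𝔹), h_{N−1}(X−𝔹), …, h_{N+1−m}(X−𝔹)`. -/
noncomputable def HId : Ideal ↥(SymXB m N) :=
  Ideal.span {p : ↥(SymXB m N) | ∃ t : ℕ, N + 1 - m ≤ t ∧ t ≤ N ∧
    (p : PXB m N) = hdiff (XS m N) (BS m N) t}

/-- Partitions with at most `m` parts, each of size at most `n`. -/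
def PartitionIn (m n : ℕ) : Type :=
  {l : Fin m → ℕ // Antitone l ∧ ∀ i, l i ≤ n}

lemma esymmF_zero {σ : Type*} [DecidableEq σ] (A : Finset σ) : esymmF A 0 = 1 := by
  simp [esymmF]

lemma esymmF_insert {σ : Type*} [DecidableEq σ] {A : Finset σ} {a : σ} (ha : a ∉ A) (n : ℕ) :
    esymmF (insert a A) (n + 1) = esymmF A (n + 1) + X a * esymmF A n := by
  unfold esymmF
  rw [Finset.powersetCard_succ_insert ha, Finset.sum_union, Finset.sum_image, Finset.mul_sum]
  · congr 1
    refine Finset.sum_congr rfl fun s hs => Finset.prod_insert fun h => ?_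
    exact ha ((Finset.mem_powersetCard.1 hs).1 h)
  · intro s hs t ht h
    have key : ∀ u ∈ Finset.powersetCard n A, a ∉ u := fun u hu h =>
      ha ((Finset.mem_powersetCard.1 hu).1 h)
    rw [← Finset.erase_insert (key s hs), ← Finset.erase_insert (key t ht), h]
  · rw [Finset.disjoint_left]
    intro s hs hs'
    obtain ⟨u, -, rfl⟩ := Finset.mem_image.1 hs'
    exact ha ((Finset.mem_powersetCard.1 hs).1 (Finset.mem_insert_self _ _))

lemma esymmF_eq_zero {σ : Type*} [DecidableEq σ] {A : Finset σ} {n : ℕ} (h : A.card < n) :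
    esymmF A n = 0 := by
  simp [esymmF, Finset.powersetCard_eq_empty.2 h]

lemma hsymmF_zero {σ : Type*} [DecidableEq σ] (A : Finset σ) : hsymmF A 0 = 1 := by
  simp only [hsymmF, Finset.sym_zero, Finset.sum_singleton]
  exact Multiset.prod_zero

lemma hsymmF_insert {σ : Type*} [DecidableEq σ] {A : Finset σ} {a : σ} (ha : a ∉ A) (n : ℕ) :
    hsymmF (insert a A) (n + 1) = hsymmF A (n + 1) + X a * hsymmF (insert a A) n := by
  unfold hsymmF
  rw [← Finset.sum_filter_not_add_sum_filter (s := (insert a A).sym (n + 1)) (a ∈ ·)]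
  congr 1
  · refine Finset.sum_congr ?_ fun _ _ => rfl
    ext s
    simp only [Finset.mem_filter, Finset.mem_sym_iff, Finset.mem_insert]
    constructor
    · rintro ⟨h, h'⟩ b hb
      exact (h b hb).resolve_left (by rintro rfl; exact h' hb)
    · exact fun h => ⟨fun b hb => Or.inr (h b hb), fun h' => ha (h a h')⟩
  · rw [Finset.mul_sum]
    symm
    refine Finset.sum_bij (fun s _ => a ::ₛ s) ?_ ?_ ?_ ?_
    · intro s hs
      rw [Finset.mem_filter, Finset.mem_sym_iff]
      refine ⟨fun b hb => ?_, Sym.mem_cons_self a s⟩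
      rcases Sym.mem_cons.1 hb with rfl | hb
      · exact Finset.mem_insert_self _ _
      · exact Finset.mem_sym_iff.1 hs b hb
    · intro s _ t _ h
      exact Sym.cons_inj_right a s t |>.1 h
    · intro s hs
      rw [Finset.mem_filter, Finset.mem_sym_iff] at hs
      refine ⟨s.erase a hs.2, ?_, Sym.cons_erase hs.2⟩
      rw [Finset.mem_sym_iff]
      exact fun b hb => hs.1 b (Multiset.mem_of_mem_erase hb)
    · intro s _
      rw [Sym.coe_cons, Multiset.map_cons, Multiset.prod_cons]

/-- The generating series `∏ (1 - x t)` of the signed elementary symmetric polynomials. -/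
noncomputable def esymmSeries {σ : Type*} [DecidableEq σ] (A : Finset σ) :
    PowerSeries (MvPolynomial σ ℂ) :=
  ∏ i ∈ A, (1 - PowerSeries.C (X i) * PowerSeries.X)

lemma coeff_esymmSeries {σ : Type*} [DecidableEq σ] (A : Finset σ) (n : ℕ) :
    PowerSeries.coeff n (esymmSeries A) = (-1) ^ n * esymmF A n := by
  induction A using Finset.induction_on generalizing n with
  | empty =>
    rcases n with _ | n
    · simp [esymmSeries, esymmF]
    · rw [esymmF_eq_zero (by simp)]
      simp [esymmSeries, PowerSeries.coeff_one]
  | insert a A ha ih =>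
    have h : esymmSeries (insert a A) =
        esymmSeries A - PowerSeries.C (X a) * (esymmSeries A * PowerSeries.X) := by
      rw [esymmSeries, Finset.prod_insert ha, ← esymmSeries]
      ring
    rw [h, map_sub, PowerSeries.coeff_C_mul]
    rcases n with _ | n
    · rw [ih]
      simp [esymmF_zero]
    · rw [PowerSeries.coeff_succ_mul_X, ih, ih, esymmF_insert ha]
      ring

lemma mk_hsymmF_mul_esymmSeries {σ : Type*} [DecidableEq σ] (A : Finset σ) :
    PowerSeries.mk (hsymmF A) * esymmSeries A = 1 := by
  induction A using Finset.induction_on with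
  | empty =>
    ext1 n
    rcases n with _ | n
    · simp [esymmSeries, hsymmF_zero]
    · simp [esymmSeries, PowerSeries.coeff_one, hsymmF]
  | insert a A ha ih =>
    have h : PowerSeries.mk (hsymmF (insert a A)) * (1 - PowerSeries.C (X a) * PowerSeries.X) =
        PowerSeries.mk (hsymmF A) := by
      have h' : PowerSeries.mk (hsymmF (insert a A)) * (1 - PowerSeries.C (X a) * PowerSeries.X) =
          PowerSeries.mk (hsymmF (insert a A)) -
            PowerSeries.C (X a) * (PowerSeries.mk (hsymmF (insert a A)) * PowerSeries.X) := by
        ring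
      rw [h']
      ext1 n
      rw [map_sub, PowerSeries.coeff_C_mul]
      rcases n with _ | n
      · simp [hsymmF_zero]
      · rw [PowerSeries.coeff_succ_mul_X]
        simp [hsymmF_insert ha]
    rw [esymmSeries, Finset.prod_insert ha, ← mul_assoc, h]
    exact ih

lemma mk_hdiff {σ : Type*} [DecidableEq σ] (A B : Finset σ) :
    PowerSeries.mk (hdiff A B) = esymmSeries B * PowerSeries.mk (hsymmF A) := by
  ext1 n
  rw [PowerSeries.coeff_mk, PowerSeries.coeff_mul, Finset.Nat.sum_antidiagonal_eq_sum_range_succ_mk]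
  simp [hdiff, coeff_esymmSeries]

lemma hdiff_self {σ : Type*} [DecidableEq σ] (A : Finset σ) (n : ℕ) :
    hdiff A A n = if n = 0 then 1 else 0 := by
  have h := congrArg (PowerSeries.coeff n) (mk_hdiff A A)
  rw [mul_comm, mk_hsymmF_mul_esymmSeries] at h
  simpa [PowerSeries.coeff_one] using h

lemma hdiff_empty {σ : Type*} [DecidableEq σ] (A : Finset σ) (n : ℕ) :
    hdiff A ∅ n = hsymmF A n := by
  have h := congrArg (PowerSeries.coeff n) (mk_hdiff A ∅)
  simpa [esymmSeries] using h

lemma hdiff_zero {σ : Type*} [DecidableEq σ] (A B : Finset σ) : hdiff A B 0 = 1 := by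
  simp [hdiff, hsymmF_zero, esymmF_zero]

lemma mk_hdiff_mul_esymmSeries {σ : Type*} [DecidableEq σ] {A A' B : Finset σ} (h : A' ⊆ A) :
    esymmSeries (A \ A') * PowerSeries.mk (hdiff A B) = PowerSeries.mk (hdiff A' B) := by
  have h1 : esymmSeries A = esymmSeries (A \ A') * esymmSeries A' := by
    rw [esymmSeries, esymmSeries, esymmSeries, Finset.prod_sdiff h]
  have h2 := mk_hsymmF_mul_esymmSeries A
  have h3 := mk_hsymmF_mul_esymmSeries A'
  rw [mk_hdiff, mk_hdiff]
  rw [h1] at h2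
  linear_combination (esymmSeries B * PowerSeries.mk (hsymmF A')) * h2 -
    (esymmSeries B * PowerSeries.mk (hsymmF A) * esymmSeries (A \ A')) * h3

lemma hdiffZ_natCast {σ : Type*} [DecidableEq σ] (A B : Finset σ) (n : ℕ) :
    hdiffZ A B n = hdiff A B n := by
  simp [hdiffZ]

lemma hdiffZ_of_neg {σ : Type*} [DecidableEq σ] (A B : Finset σ) {n : ℤ} (h : n < 0) :
    hdiffZ A B n = 0 := by
  simp [hdiffZ, not_le.2 h]

/-- Removing part of the first alphabet: `h_n(A' - B) = ∑ (-1)^k e_k(A \ A') h_{n-k}(A - B)`, where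
the sum may be cut off anywhere beyond `n` or beyond the size of
the removed part `A \ A'` of the alphabet. -/
lemma hdiffZ_eq_sum_sdiff {σ : Type*} [DecidableEq σ] {A A' : Finset σ} (B : Finset σ) (h : A' ⊆ A)
    (n : ℤ) (K : ℕ) (hK : n ≤ K ∨ (A \ A').card ≤ K) :
    hdiffZ A' B n =
      ∑ k ∈ Finset.range (K + 1), (-1) ^ k * esymmF (A \ A') k * hdiffZ A B (n - k) := by
  rcases lt_or_ge n 0 with hn | hn
  · rw [hdiffZ_of_neg _ _ hn]
    refine (Finset.sum_eq_zero fun k _ => ?_).symm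
    rw [hdiffZ_of_neg _ _ (by lia), mul_zero]
  lift n to ℕ using hn
  have h1 := congrArg (PowerSeries.coeff n) (mk_hdiff_mul_esymmSeries (B := B) h)
  rw [PowerSeries.coeff_mk, PowerSeries.coeff_mul,
    Finset.Nat.sum_antidiagonal_eq_sum_range_succ_mk] at h1
  rw [hdiffZ_natCast, ← h1]
  have h2 : ∀ k ∈ Finset.range (n + 1), PowerSeries.coeff k (esymmSeries (A \ A')) *
      PowerSeries.coeff (n - k) (PowerSeries.mk (hdiff A B)) =
      (-1) ^ k * esymmF (A \ A') k * hdiffZ A B ((n : ℤ) - k) := by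
    intro k hk
    rw [coeff_esymmSeries, PowerSeries.coeff_mk,
      ← Nat.cast_sub (by have := Finset.mem_range.1 hk; lia), hdiffZ_natCast]
  rw [Finset.sum_congr rfl h2]
  rcases le_total n K with hnK | hnK
  · refine Finset.sum_subset (Finset.range_subset_range.2 (by lia)) fun k _ hk => ?_
    rw [hdiffZ_of_neg _ _ (by have := Finset.mem_range.not.1 hk; lia), mul_zero]
  · refine (Finset.sum_subset (Finset.range_subset_range.2 (by lia)) fun k hk hk' => ?_).symm
    have h3 := Finset.mem_range.not.1 hk'
    have h4 := Finset.mem_range.1 hk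
    rw [esymmF_eq_zero (by lia)]
    ring

/-- `h_n(A - B) = ∑ (-1)^k e_k(B) h_{n-k}(A)`, where the sum may be cut off anywhere beyond `n` or
beyond the size of `B`. -/
lemma hdiffZ_eq_sum {σ : Type*} [DecidableEq σ] (A B : Finset σ)
    (n : ℤ) (K : ℕ) (hK : n ≤ K ∨ B.card ≤ K) :
    hdiffZ A B n =
      ∑ k ∈ Finset.range (K + 1), (-1) ^ k * esymmF B k * hdiffZ A ∅ (n - k) := by
  rcases lt_or_ge n 0 with hn | hn
  · rw [hdiffZ_of_neg _ _ hn]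
    refine (Finset.sum_eq_zero fun k _ => ?_).symm
    rw [hdiffZ_of_neg _ _ (by lia), mul_zero]
  lift n to ℕ using hn
  rw [hdiffZ_natCast, hdiff]
  have h2 : ∀ k ∈ Finset.range (n + 1), (-1) ^ k * esymmF B k * hsymmF A (n - k) =
      (-1) ^ k * esymmF B k * hdiffZ A ∅ ((n : ℤ) - k) := by
    intro k hk
    rw [← Nat.cast_sub (by have := Finset.mem_range.1 hk; lia), hdiffZ_natCast, hdiff_empty]
  rw [Finset.sum_congr rfl h2]
  rcases le_total n K with hnK | hnK
  · refine Finset.sum_subset (Finset.range_subset_range.2 (by lia)) fun k _ hk => ?_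
    rw [hdiffZ_of_neg _ _ (by have := Finset.mem_range.not.1 hk; lia), mul_zero]
  · refine (Finset.sum_subset (Finset.range_subset_range.2 (by lia)) fun k hk hk' => ?_).symm
    have h3 := Finset.mem_range.not.1 hk'
    have h4 := Finset.mem_range.1 hk
    rw [esymmF_eq_zero (by lia)]
    ring

lemma map_esymmSeries_rename {σ τ : Type*} [DecidableEq σ] [DecidableEq τ] {f : σ → τ}
    (hf : Function.Injective f) (A : Finset σ) :
    PowerSeries.map (rename f : MvPolynomial σ ℂ →ₐ[ℂ] MvPolynomial τ ℂ).toRingHom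
      (esymmSeries A) = esymmSeries (A.image f) := by
  rw [esymmSeries, esymmSeries, map_prod, Finset.prod_image hf.injOn]
  refine Finset.prod_congr rfl fun i _ => ?_
  simp

lemma rename_esymmF {σ τ : Type*} [DecidableEq σ] [DecidableEq τ] {f : σ → τ}
    (hf : Function.Injective f) (A : Finset σ) (n : ℕ) :
    rename f (esymmF A n) = esymmF (A.image f) n := by
  have h := congrArg (PowerSeries.coeff n) (map_esymmSeries_rename hf A)
  rw [PowerSeries.coeff_map, coeff_esymmSeries, coeff_esymmSeries] at h
  have h' : (-1 : MvPolynomial τ ℂ) ^ n * rename f (esymmF A n) =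
      (-1) ^ n * esymmF (A.image f) n := by
    simpa using h
  exact mul_left_cancel₀ (pow_ne_zero n (neg_ne_zero.2 one_ne_zero)) h'

lemma rename_hsymmF {σ τ : Type*} [DecidableEq σ] [DecidableEq τ] {f : σ → τ}
    (hf : Function.Injective f) (A : Finset σ) (n : ℕ) :
    rename f (hsymmF A n) = hsymmF (A.image f) n := by
  have h1 := congrArg (PowerSeries.map
    (rename f : MvPolynomial σ ℂ →ₐ[ℂ] MvPolynomial τ ℂ).toRingHom) (mk_hsymmF_mul_esymmSeries A)
  rw [map_mul, map_esymmSeries_rename hf, map_one] at h1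
  have h2 := mk_hsymmF_mul_esymmSeries (A.image f)
  have h3 : PowerSeries.map (rename f : MvPolynomial σ ℂ →ₐ[ℂ] MvPolynomial τ ℂ).toRingHom
      (PowerSeries.mk (hsymmF A)) = PowerSeries.mk (hsymmF (A.image f)) := by
    rw [mul_comm] at h2
    exact left_inv_eq_right_inv h1 h2
  simpa using congrArg (PowerSeries.coeff n) h3

lemma rename_hdiffZ {σ τ : Type*} [DecidableEq σ] [DecidableEq τ] {f : σ → τ}
    (hf : Function.Injective f) (A B : Finset σ) (n : ℤ) :
    rename f (hdiffZ A B n) = hdiffZ (A.image f) (B.image f) n := by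
  unfold hdiffZ
  split_ifs
  · simp [hdiff, rename_esymmF hf, rename_hsymmF hf]
  · simp

lemma hdiffZ_singleton {σ : Type*} [DecidableEq σ] (a : σ) (n : ℕ) :
    hdiffZ {a} ∅ n = X a ^ n := by
  rw [hdiffZ_natCast, hdiff_empty, hsymmF, Finset.sym_singleton, Finset.sum_singleton,
    Sym.coe_replicate, Multiset.map_replicate, Multiset.prod_replicate]

/-- The alternant `det (x_l ^ (m - 1 - i))`. -/
noncomputable def alternant {σ : Type*} {m : ℕ} (x : Fin m → σ) : MvPolynomial σ ℂ :=
  (Matrix.of fun i l : Fin m => (X (x l) : MvPolynomial σ ℂ) ^ (Fin.rev i : ℕ)).det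

lemma alternant_eq {σ : Type*} {m : ℕ} (x : Fin m → σ) :
    alternant x = ((Equiv.Perm.sign (Fin.revPerm (n := m)) : ℤ) : MvPolynomial σ ℂ) *
      (Matrix.vandermonde fun l => (X (x l) : MvPolynomial σ ℂ)).det := by
  rw [← Matrix.det_transpose (Matrix.vandermonde _), ← Matrix.det_permute]
  rfl

lemma alternant_ne_zero {σ : Type*} {m : ℕ} {x : Fin m → σ} (hx : Function.Injective x) :
    alternant x ≠ 0 := by
  rw [alternant_eq]
  refine mul_ne_zero ?_ (Matrix.det_vandermonde_ne_zero_iff.2 fun i j h => hx (X_injective h))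
  rcases Int.units_eq_one_or (Equiv.Perm.sign (Fin.revPerm (n := m))) with h | h <;> simp [h]

lemma det_hdiffZ_unitriangular {σ : Type*} [DecidableEq σ] (A B : Finset σ) (m : ℕ) :
    (Matrix.of fun i j : Fin m => hdiffZ A B (-(i : ℤ) + j)).det = 1 := by
  rw [Matrix.det_of_isUpperTriangular]
  · refine Finset.prod_eq_one fun i _ => ?_
    rw [Matrix.of_apply, neg_add_cancel, ← Nat.cast_zero, hdiffZ_natCast, hdiff_zero]
  · intro i j h
    exact hdiffZ_of_neg _ _ (by have : (j : ℕ) < i := h; lia)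

/-- The bialternant formula for the Jacobi-Trudi determinants of `X - B`. -/
lemma det_hdiffZ_singleton {σ : Type*} [DecidableEq σ] {m : ℕ} {x : Fin m → σ}
    (hx : Function.Injective x) (B : Finset σ) (a : Fin m → ℤ) :
    (Matrix.of fun i l : Fin m => hdiffZ {x l} B (a i)).det =
      (Matrix.of fun i j : Fin m =>
        hdiffZ (Finset.univ.image x) B (a i - (m - 1) + j)).det * alternant x := by
  set A := Finset.univ.image x with hA
  set W : Matrix (Fin m) (Fin m) (MvPolynomial σ ℂ) := Matrix.of fun j l =>
    (-1) ^ (Fin.rev j : ℕ) * esymmF (A \ {x l}) (Fin.rev j) with hW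
  have key : ∀ (B : Finset σ) (a : Fin m → ℤ),
      (Matrix.of fun i l : Fin m => hdiffZ {x l} B (a i)).det =
        (Matrix.of fun i j : Fin m => hdiffZ A B (a i - (m - 1) + j)).det * W.det := by
    intro B a
    rw [← Matrix.det_mul]
    congr 1
    ext1 i l
    have hl : {x l} ⊆ A := by simp [hA]
    have hc : A.card = m := by simp [hA, Finset.card_image_of_injective _ hx]
    have hm := l.pos
    rw [Matrix.of_apply, hdiffZ_eq_sum_sdiff B hl (a i) (m - 1)
      (Or.inr (by rw [Finset.card_sdiff_of_subset hl, hc, Finset.card_singleton])),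
      Nat.sub_add_cancel hm, Finset.sum_range, Matrix.mul_apply, ← Equiv.sum_comp Fin.revPerm]
    refine Finset.sum_congr rfl fun j _ => ?_
    rw [hW, Matrix.of_apply, Matrix.of_apply, mul_comm, Fin.revPerm_apply]
    congr 2
    have := j.isLt
    rw [Fin.val_rev]
    lia
  have hWV : W.det = alternant x := by
    have h := key ∅ fun i => (Fin.rev i : ℕ)
    have h1 : (Matrix.of fun i j : Fin m =>
        hdiffZ A ∅ ((((Fin.rev i : ℕ)) : ℤ) - (m - 1) + j)).det = 1 := by
      rw [← det_hdiffZ_unitriangular A ∅ m]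
      congr 2
      ext1 i
      ext1 j
      have := i.isLt
      congr 1
      rw [Fin.val_rev]
      lia
    rw [h1, one_mul] at h
    rw [← h, alternant]
    simp_rw [hdiffZ_singleton]
  rw [key, hWV]

lemma image_sumCongr_XS {m N : ℕ} (e : Equiv.Perm (Fin m)) (g : Equiv.Perm (Fin N)) :
    (XS m N).image (Equiv.sumCongr e g) = XS m N := by
  rw [XS, Finset.image_image]
  exact (Finset.image_image (f := e) (g := Sum.inl)).symm.trans
    (congrArg _ (Finset.image_univ_equiv e))

lemma image_sumCongr_BS {m N : ℕ} (e : Equiv.Perm (Fin m)) (g : Equiv.Perm (Fin N)) :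
    (BS m N).image (Equiv.sumCongr e g) = BS m N := by
  rw [BS, Finset.image_image]
  exact (Finset.image_image (f := g) (g := Sum.inr)).symm.trans
    (congrArg _ (Finset.image_univ_equiv g))

/-- `h_t(X)` as an element of `Sym(X|𝔹)`. -/
noncomputable def hX (m N : ℕ) (t : ℤ) : SymXB m N :=
  ⟨hdiffZ (XS m N) ∅ t, fun e g => by
    rw [rename_hdiffZ (Equiv.injective _), image_sumCongr_XS, Finset.image_empty]⟩

/-- `h_t(X - 𝔹)` as an element of `Sym(X|𝔹)`. -/
noncomputable def hXB (m N : ℕ) (t : ℤ) : SymXB m N :=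
  ⟨hdiffZ (XS m N) (BS m N) t, fun e g => by
    rw [rename_hdiffZ (Equiv.injective _), image_sumCongr_XS, image_sumCongr_BS]⟩

/-- `e_k(X)` as an element of `Sym(X|𝔹)`. -/
noncomputable def eX (m N : ℕ) (k : ℕ) : SymXB m N :=
  ⟨esymmF (XS m N) k, fun e g => by
    rw [rename_esymmF (Equiv.injective _), image_sumCongr_XS]⟩

/-- `e_k(𝔹)` as an element of `Sym(𝔹)`. -/
noncomputable def eB (m N : ℕ) (k : ℕ) : SymB m N :=
  ⟨⟨esymmF (BS m N) k, fun e g => by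
    rw [rename_esymmF (Equiv.injective _), image_sumCongr_BS]⟩,
    esymmF Finset.univ k, by rw [rename_esymmF Sum.inr_injective]; rfl⟩

lemma card_XS (m N : ℕ) : (XS m N).card = m := by
  simp [XS, Finset.card_image_of_injective _ Sum.inl_injective]

lemma card_BS (m N : ℕ) : (BS m N).card = N := by
  simp [BS, Finset.card_image_of_injective _ Sum.inr_injective]

lemma hXB_mem_HId {m N : ℕ} (t : ℕ) (ht : N + 1 - m ≤ t) :
    hXB m N t ∈ HId m N := by
  induction t using Nat.strong_induction_on with
  | _ t ih =>
    rcases le_or_gt t N with htN | htN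
    · exact Ideal.subset_span ⟨t, ht, htN, hdiffZ_natCast _ _ t⟩
    have h1 : hdiffZ ∅ (BS m N) (t : ℤ) = 0 := by
      rw [hdiffZ_eq_sum _ _ _ N (Or.inr (card_BS m N).le)]
      refine Finset.sum_eq_zero fun k hk => ?_
      have hk' := Finset.mem_range.1 hk
      rw [← Nat.cast_sub (by lia), hdiffZ_natCast, hdiff_self, if_neg (by lia), mul_zero]
    rw [hdiffZ_eq_sum_sdiff _ (Finset.empty_subset (XS m N)) _ m
      (Or.inr (by rw [Finset.sdiff_empty, card_XS])), Finset.sdiff_empty,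
      Finset.sum_range_succ'] at h1
    have h2 : hXB m N t = - ∑ k ∈ Finset.range m,
        (-1) ^ (k + 1) * eX m N (k + 1) * hXB m N (t - (k + 1 : ℕ)) := by
      apply Subtype.ext
      push_cast
      rw [eq_neg_iff_add_eq_zero, add_comm]
      simpa [esymmF_zero, eX, hXB] using h1
    rw [h2]
    refine neg_mem (Ideal.sum_mem _ fun k hk => Ideal.mul_mem_left _ _ ?_)
    have hk' := Finset.mem_range.1 hk
    rcases le_or_gt (k + 1) t with hkt | hkt
    · rw [← Nat.cast_sub hkt]
      exact ih _ (by lia) (by lia)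
    · have : hXB m N (t - (k + 1 : ℕ)) = 0 := Subtype.ext (hdiffZ_of_neg _ _ (by lia))
      rw [this]
      exact zero_mem _

lemma hXB_eq_sum {m N : ℕ} (t : ℤ) :
    hXB m N t = ∑ k ∈ Finset.range (N + 1), (-1) ^ k * (eB m N k : SymXB m N) * hX m N (t - k) := by
  apply Subtype.ext
  push_cast
  exact hdiffZ_eq_sum _ _ t N (Or.inr (card_BS m N).le)

/-- The Schur polynomial in `X` with shifted index `a i = λ i + (m - 1 - i)`, for arbitrary
exponents `a`. -/
noncomputable def shiftedSchur (m N : ℕ) (a : Fin m → ℕ) : SymXB m N :=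
  (Matrix.of fun i j : Fin m => hX m N (a i - (m - 1) + j)).det

lemma det_mem_of_row_mem {R : Type*} [CommRing R] {m : ℕ} (I : Ideal R)
    (M : Matrix (Fin m) (Fin m) R) (i : Fin m) (h : ∀ j, M i j ∈ I) : M.det ∈ I := by
  rw [← Matrix.det_transpose, Matrix.det_apply]
  refine Submodule.sum_mem _ fun σ _ => ?_
  rw [Units.smul_def]
  refine zsmul_mem (Ideal.mem_of_dvd _ (Finset.dvd_prod_of_mem _ (Finset.mem_univ i)) ?_) _
  exact h _

lemma shiftedSchur_add_sum_mem_HId {m N : ℕ} (h2 : m ≤ N) (a : Fin m → ℕ) (i : Fin m)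
    (hi : N ≤ a i) :
    shiftedSchur m N a + ∑ k ∈ Finset.range N, ((-1) ^ (k + 1) * eB m N (k + 1)) •
      shiftedSchur m N (Function.update a i (a i - (k + 1))) ∈ HId m N := by
  set M : Matrix (Fin m) (Fin m) (SymXB m N) :=
    Matrix.of fun i j : Fin m => hX m N (a i - (m - 1) + j) with hM
  have hrow : (fun j : Fin m => hXB m N (a i - (m - 1) + j)) = ∑ k ∈ Finset.range (N + 1),
      ((-1) ^ k * (eB m N k : SymXB m N)) • fun j : Fin m => hX m N ((a i - k) - (m - 1) + j) := by
    ext1 j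
    rw [hXB_eq_sum, Finset.sum_apply]
    refine Finset.sum_congr rfl fun k _ => ?_
    rw [Pi.smul_apply, smul_eq_mul]
    congr 2
    ring
  have hdet : (M.updateRow i fun j : Fin m => hXB m N (a i - (m - 1) + j)).det ∈ HId m N := by
    refine det_mem_of_row_mem _ _ i fun j => ?_
    rw [Matrix.updateRow_self]
    have h3 : ((a i : ℤ) - (m - 1) + j) = ((a i + 1 + j - m : ℕ) : ℤ) := by
      rw [Nat.cast_sub (by lia)]
      push_cast
      ring
    rw [h3]
    exact hXB_mem_HId _ (by lia)
  rw [hrow] at hdet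
  have hlin : (M.updateRow i (∑ k ∈ Finset.range (N + 1), ((-1) ^ k * (eB m N k : SymXB m N)) •
      fun j : Fin m => hX m N ((a i - k) - (m - 1) + j))).det =
      ∑ k ∈ Finset.range (N + 1), ((-1) ^ k * (eB m N k : SymXB m N)) *
        (M.updateRow i fun j : Fin m => hX m N ((a i - k) - (m - 1) + j)).det := by
    refine (Matrix.detRowAlternating.toMultilinearMap.map_update_sum _ i _ M).trans ?_
    refine Finset.sum_congr rfl fun k _ => ?_
    exact Matrix.det_updateRow_smul M i _ _
  rw [hlin, Finset.sum_range_succ', add_comm] at hdet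
  convert hdet using 1
  refine congrArg₂ (· + ·) ?_ ?_
  · have h0 : eB m N 0 = 1 := Subtype.ext (Subtype.ext (esymmF_zero (BS m N)))
    rw [h0, pow_zero, OneMemClass.coe_one, one_mul, one_mul, shiftedSchur, ← hM]
    congr 1
    have : (fun j : Fin m => hX m N ((a i - (0 : ℕ)) - (m - 1) + j)) = M i := by
      ext1 j
      simp [hM]
    rw [this, Matrix.updateRow_eq_self]
  · refine Finset.sum_congr rfl fun k hk => ?_
    have hk' := Finset.mem_range.1 hk
    rw [Algebra.smul_def]
    congr 1
    rw [shiftedSchur]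
    congr 1
    ext i' j : 2
    rw [Matrix.of_apply, Matrix.updateRow_apply, Function.update_apply]
    split_ifs with h
    · rw [Nat.cast_sub (by lia)]
    · rfl

lemma strictAnti_sort {m : ℕ} (a : Fin m → ℕ) (ha : Function.Injective a) :
    ∃ σ : Equiv.Perm (Fin m), StrictAnti (a ∘ σ) := by
  refine ⟨Fin.revPerm.trans (Tuple.sort a), ?_⟩
  have h1 : StrictMono (a ∘ Tuple.sort a) :=
    (Tuple.monotone_sort a).strictMono_of_injective (ha.comp (Equiv.injective _))
  exact fun i j hij => h1 (Fin.rev_lt_rev.2 hij)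

/-- Any strictly decreasing sequence of `m` naturals below `N` is a shifted partition. -/
lemma exists_partitionIn {m N : ℕ} (h2 : m ≤ N) (a : Fin m → ℕ) (ha : StrictAnti a)
    (haN : ∀ i, a i < N) :
    ∃ l : PartitionIn m (N - m), ∀ i, l.1 i + Fin.rev i = a i := by
  have hstep : ∀ i j : Fin m, i ≤ j → a j + (j - i : ℕ) ≤ a i := by
    intro i j hij
    obtain ⟨j, hj⟩ := j
    induction j with
    | zero =>
      have : i = ⟨0, hj⟩ := le_antisymm hij (Fin.mk_le_of_le_val (Nat.zero_le _))
      subst this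
      simp
    | succ j ih =>
      rcases hij.eq_or_lt with rfl | hij
      · simp
      · have hij' : (i : ℕ) < j + 1 := hij
        have h3 := ih (by lia) (show (i : ℕ) ≤ j by lia)
        have h4 : a ⟨j + 1, hj⟩ < a ⟨j, by lia⟩ := ha (show j < j + 1 by lia)
        simp only at h3 ⊢
        lia
  have hrev : ∀ i : Fin m, (Fin.rev i : ℕ) ≤ a i := by
    intro i
    have hi := i.isLt
    have := hstep i ⟨m - 1, by lia⟩ (show (i : ℕ) ≤ m - 1 by lia)
    rw [Fin.val_rev]
    simp only at this
    lia
  have hbound : ∀ i : Fin m, a i - Fin.rev i ≤ N - m := by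
    intro i
    have hi := i.isLt
    have h3 := hstep ⟨0, by lia⟩ i (Nat.zero_le _)
    have h4 := haN ⟨0, by lia⟩
    rw [Fin.val_rev]
    simp only at h3
    lia
  refine ⟨⟨fun i => a i - Fin.rev i, fun i j hij => ?_, hbound⟩, fun i => ?_⟩
  · have h3 := hstep i j hij
    have h4 := hrev j
    have hi := i.isLt
    have hj := j.isLt
    have hij' : (i : ℕ) ≤ j := hij
    simp only [Fin.val_rev] at h4 ⊢
    lia
  · exact Nat.sub_add_cancel (hrev i)

lemma coe_shiftedSchur {m N : ℕ} (a l : Fin m → ℕ) (h : ∀ i, l i + Fin.rev i = a i) :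
    (shiftedSchur m N a : PXB m N) = SchurP (XS m N) l := by
  rw [shiftedSchur, SchurP, SchurDiff]
  refine (AlgHom.map_det (SymXB m N).val _).trans ?_
  congr 1
  ext i j : 1
  refine congrArg (hdiffZ (XS m N) ∅) ?_
  have hi := i.isLt
  have := h i
  rw [Fin.val_rev] at this
  lia

lemma det_eq_or_eq_neg_det_submatrix {R : Type*} [CommRing R] {m : ℕ}
    (M : Matrix (Fin m) (Fin m) R) (σ : Equiv.Perm (Fin m)) :
    M.det = (M.submatrix σ id).det ∨ M.det = -(M.submatrix σ id).det := by
  rw [Matrix.det_permute]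
  rcases Int.units_eq_one_or (Equiv.Perm.sign σ) with h | h <;> simp [h]

lemma shiftedSchur_comp_perm {m N : ℕ} (a : Fin m → ℕ) (σ : Equiv.Perm (Fin m)) :
    shiftedSchur m N a = shiftedSchur m N (a ∘ σ) ∨
      shiftedSchur m N a = -shiftedSchur m N (a ∘ σ) :=
  det_eq_or_eq_neg_det_submatrix _ σ

lemma mk_shiftedSchur_mem_span {m N : ℕ} (h2 : m ≤ N)
    (s : PartitionIn m (N - m) → ↥(SymXB m N))
    (hs : ∀ l, ((s l : PXB m N)) = SchurP (XS m N) l.1) (a : Fin m → ℕ) :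
    Ideal.Quotient.mk (HId m N) (shiftedSchur m N a) ∈
      Submodule.span (SymB m N) (Set.range fun l => Ideal.Quotient.mk (HId m N) (s l)) := by
  have hneg : ∀ z : ↥(SymXB m N) ⧸ HId m N,
      z ∈ Submodule.span (SymB m N) (Set.range fun l => Ideal.Quotient.mk (HId m N) (s l)) →
      -z ∈ Submodule.span (SymB m N) (Set.range fun l => Ideal.Quotient.mk (HId m N) (s l)) := by
    intro z hz
    have h3 := Submodule.smul_mem _ (-1 : SymB m N) hz
    obtain ⟨x, rfl⟩ := Ideal.Quotient.mk_surjective z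
    have h4 : (-1 : SymB m N) • Ideal.Quotient.mk (HId m N) x = -Ideal.Quotient.mk (HId m N) x := by
      rw [← map_neg]
      exact congrArg _ (neg_one_mul x)
    rwa [h4] at h3
  induction h : ∑ i, a i using Nat.strong_induction_on generalizing a with
  | _ n ih =>
    by_cases hN : ∃ i, N ≤ a i
    · obtain ⟨i, hi⟩ := hN
      have h3 := Ideal.Quotient.eq_zero_iff_mem.2 (shiftedSchur_add_sum_mem_HId h2 a i hi)
      rw [map_add, add_eq_zero_iff_eq_neg, map_sum] at h3
      rw [h3]
      refine hneg _ (Submodule.sum_mem _ fun k hk => ?_)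
      refine Submodule.smul_mem _ ((-1) ^ (k + 1) * eB m N (k + 1))
        (ih _ ?_ (Function.update a i (a i - (k + 1))) rfl)
      have := Finset.mem_range.1 hk
      rw [← h]
      refine Finset.sum_lt_sum (fun j _ => ?_) ⟨i, Finset.mem_univ _, ?_⟩
      · rw [Function.update_apply]
        split_ifs with h4
        · subst h4
          lia
        · exact le_rfl
      · rw [Function.update_self]
        lia
    · push Not at hN
      by_cases ha : Function.Injective a
      · obtain ⟨σ, hσ⟩ := strictAnti_sort a ha
        obtain ⟨l, hl⟩ := exists_partitionIn h2 (a ∘ σ) hσ fun i => hN _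
        have h3 : shiftedSchur m N (a ∘ σ) = s l :=
          Subtype.ext ((coe_shiftedSchur _ _ hl).trans (hs l).symm)
        have h4 : Ideal.Quotient.mk (HId m N) (s l) ∈ Submodule.span (SymB m N)
            (Set.range fun l => Ideal.Quotient.mk (HId m N) (s l)) :=
          Submodule.subset_span ⟨l, rfl⟩
        rw [← h3] at h4
        rcases shiftedSchur_comp_perm (N := N) a σ with h5 | h5
        · rw [h5]
          exact h4
        · rw [h5, map_neg]
          exact hneg _ h4
      · rw [Function.not_injective_iff] at ha
        obtain ⟨i, j, hij, hne⟩ := ha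
        have : shiftedSchur m N a = 0 := Matrix.det_zero_of_row_eq hne (by
          ext1 k
          rw [Matrix.of_apply, Matrix.of_apply, hij])
        rw [this, map_zero]
        exact zero_mem _

lemma rename_alternant {m : ℕ} {σ : Type*} (x : Fin m → σ) (f : σ → σ) (e : Equiv.Perm (Fin m))
    (h : ∀ i, f (x i) = x (e i)) :
    rename f (alternant x) = (Equiv.Perm.sign e : ℤ) * alternant x := by
  rw [alternant, AlgHom.map_det, ← Matrix.det_permute']
  congr 1
  ext i l : 1
  simp [h]

lemma sumAlgEquiv_rename_inr {m N : ℕ} (q : MvPolynomial (Fin N) ℂ) :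
    sumAlgEquiv ℂ (Fin m) (Fin N) (rename Sum.inr q) = C q := by
  have h := DFunLike.congr_fun (sumAlgEquiv_comp_rename_inr (R := ℂ) (S₁ := Fin m) (S₂ := Fin N)) q
  simpa using h

lemma sumAlgEquiv_rename_sumCongr {m N : ℕ} (g : Equiv.Perm (Fin N))
    (p : PXB m N) :
    sumAlgEquiv ℂ (Fin m) (Fin N) (rename (Equiv.sumCongr 1 g) p) =
      map (rename g : MvPolynomial (Fin N) ℂ →ₐ[ℂ] MvPolynomial (Fin N) ℂ).toRingHom
        (sumAlgEquiv ℂ (Fin m) (Fin N) p) := by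
  induction p using MvPolynomial.induction_on with
  | C a => simp
  | add p q hp hq => simp only [map_add, hp, hq]
  | mul_X p i hp =>
    rw [map_mul, map_mul, map_mul, map_mul, hp]
    rcases i with i | i <;> simp

lemma eq_sum_coeff_sumAlgEquiv {m N : ℕ} (p : PXB m N) :
    p = ∑ a ∈ (sumAlgEquiv ℂ (Fin m) (Fin N) p).support,
      rename Sum.inr (coeff a (sumAlgEquiv ℂ (Fin m) (Fin N) p)) *
        ∏ i, (X (Sum.inl i) : PXB m N) ^ a i := by
  apply (sumAlgEquiv ℂ (Fin m) (Fin N)).injective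
  conv_lhs => rw [(sumAlgEquiv ℂ (Fin m) (Fin N) p).as_sum]
  rw [map_sum]
  refine Finset.sum_congr rfl fun a _ => ?_
  rw [map_mul, sumAlgEquiv_rename_inr, map_prod, monomial_eq, Finsupp.prod_fintype _ _ (by simp)]
  simp

lemma sum_sign_prod_eq_shiftedSchur_mul {m N : ℕ} (a : Fin m → ℕ) :
    ∑ e : Equiv.Perm (Fin m), ((Equiv.Perm.sign e : ℤ) : PXB m N) *
      ∏ i, (X (Sum.inl (e i)) : PXB m N) ^ a i =
      (shiftedSchur m N a : PXB m N) * alternant Sum.inl := by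
  have h := det_hdiffZ_singleton (Sum.inl_injective (α := Fin m) (β := Fin N)) ∅ fun i => (a i : ℤ)
  simp_rw [hdiffZ_singleton] at h
  have h1 : (shiftedSchur m N a : PXB m N) = (Matrix.of fun i j : Fin m =>
      hdiffZ (Finset.univ.image Sum.inl) ∅ ((a i : ℤ) - (m - 1) + j)).det := by
    refine (AlgHom.map_det (SymXB m N).val _).trans ?_
    rfl
  rw [h1, ← h, ← Matrix.det_transpose, Matrix.det_apply']
  rfl

lemma mem_span_shiftedSchur {m N : ℕ} (f : SymXB m N) :
    f ∈ Submodule.span (SymB m N) (Set.range (shiftedSchur m N)) := by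
  set V : PXB m N := alternant (Sum.inl : Fin m → Fin m ⊕ Fin N) with hV
  have hV0 : V ≠ 0 := alternant_ne_zero Sum.inl_injective
  set G := sumAlgEquiv ℂ (Fin m) (Fin N) (f * V) with hG
  have hF := eq_sum_coeff_sumAlgEquiv ((f : PXB m N) * V)
  rw [← hG] at hF
  have hsymm : ∀ (a : Fin m →₀ ℕ) (g : Equiv.Perm (Fin N)),
      rename g (coeff a G) = coeff a G := by
    intro a g
    have h1 : rename (Equiv.sumCongr 1 g) ((f : PXB m N) * V) = (f : PXB m N) * V := by
      rw [map_mul, f.2 1 g, hV, rename_alternant _ _ 1 (by simp)]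
      simp
    have h2 := sumAlgEquiv_rename_sumCongr g ((f : PXB m N) * V)
    rw [h1, ← hG] at h2
    conv_rhs => rw [h2, coeff_map]
    rfl
  have hanti : ∀ e : Equiv.Perm (Fin m), ((Equiv.Perm.sign e : ℤ) : PXB m N) *
      rename (Equiv.sumCongr e 1) ((f : PXB m N) * V) = (f : PXB m N) * V := by
    intro e
    rw [map_mul, f.2 e 1, hV, rename_alternant _ _ e (by simp), mul_left_comm, ← mul_assoc _ _ V,
      ← Int.cast_mul, ← Units.val_mul, Int.units_mul_self]
    simp [hV]
  have hsum : (m.factorial : PXB m N) * ((f : PXB m N) * V) = ∑ a ∈ G.support,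
      rename Sum.inr (coeff a G) * ((shiftedSchur m N a : PXB m N) * V) := by
    have h1 : (m.factorial : PXB m N) * ((f : PXB m N) * V) = ∑ e : Equiv.Perm (Fin m),
        ((Equiv.Perm.sign e : ℤ) : PXB m N) *
          rename (Equiv.sumCongr e 1) ((f : PXB m N) * V) := by
      rw [Finset.sum_congr rfl fun e _ => hanti e, Finset.sum_const, Finset.card_univ,
        Fintype.card_perm, Fintype.card_fin, nsmul_eq_mul]
    rw [h1, hF]
    simp_rw [map_sum, Finset.mul_sum]
    rw [Finset.sum_comm]
    refine Finset.sum_congr rfl fun a _ => ?_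
    rw [← sum_sign_prod_eq_shiftedSchur_mul, Finset.mul_sum]
    refine Finset.sum_congr rfl fun e _ => ?_
    have h2 : rename (Equiv.sumCongr e (1 : Equiv.Perm (Fin N)))
        (rename (Sum.inr : Fin N → Fin m ⊕ Fin N) (coeff a G)) =
        rename (Sum.inr : Fin N → Fin m ⊕ Fin N) (coeff a G) := by
      rw [rename_rename]
      rfl
    rw [map_mul, h2, map_prod, mul_left_comm]
    simp
  have hcoeff : ∀ a, ∃ c : SymB m N,
      ((c : SymXB m N) : PXB m N) = rename Sum.inr (C (m.factorial : ℂ)⁻¹ * coeff a G) := by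
    intro a
    refine ⟨⟨⟨rename Sum.inr (C (m.factorial : ℂ)⁻¹ * coeff a G), fun e g => ?_⟩, _, rfl⟩, rfl⟩
    have h1 : Equiv.sumCongr e g ∘ (Sum.inr : Fin N → Fin m ⊕ Fin N) = Sum.inr ∘ g := rfl
    rw [rename_rename, h1, ← rename_rename, map_mul, rename_C, hsymm]
  choose c hc using hcoeff
  have hf : f = ∑ a ∈ G.support, c a • shiftedSchur m N a := by
    apply Subtype.ext
    apply mul_right_cancel₀ hV0
    have h3 : (C (m.factorial : ℂ)⁻¹ : PXB m N) * (m.factorial : PXB m N) = 1 := by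
      rw [← map_natCast (C (R := ℂ) (σ := Fin m ⊕ Fin N)), ← C_mul,
        inv_mul_cancel₀ (Nat.cast_ne_zero.2 m.factorial_ne_zero), C_1]
    calc (f : PXB m N) * V = C (m.factorial : ℂ)⁻¹ * ((m.factorial : PXB m N) * ((f : PXB m N) * V)) := by
          rw [← mul_assoc, h3, one_mul]
      _ = _ := by
          rw [hsum, AddSubmonoidClass.coe_finsetSum, Finset.mul_sum, Finset.sum_mul]
          refine Finset.sum_congr rfl fun a _ => ?_
          have h4 : ((c a • shiftedSchur m N a : SymXB m N) : PXB m N) =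
              ((c a : SymXB m N) : PXB m N) * shiftedSchur m N a := rfl
          rw [h4, hc, map_mul, rename_C]
          ring
  rw [hf]
  exact Submodule.sum_mem _ fun a _ => Submodule.smul_mem _ _ (Submodule.subset_span ⟨a, rfl⟩)

lemma span_mk_schur_eq_top {m N : ℕ} (h2 : m ≤ N)
    (s : PartitionIn m (N - m) → ↥(SymXB m N))
    (hs : ∀ l, ((s l : PXB m N)) = SchurP (XS m N) l.1) :
    Submodule.span (SymB m N) (Set.range fun l => Ideal.Quotient.mk (HId m N) (s l)) = ⊤ := by
  rw [eq_top_iff]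
  rintro z -
  obtain ⟨f, rfl⟩ := Ideal.Quotient.mk_surjective z
  induction mem_span_shiftedSchur f using Submodule.span_induction with
  | mem x hx =>
    obtain ⟨a, rfl⟩ := hx
    exact mk_shiftedSchur_mem_span h2 s hs a
  | zero => exact zero_mem _
  | add x y _ _ hx hy => exact add_mem hx hy
  | smul c x _ hx => exact Submodule.smul_mem _ c hx

/-- The tensor power of a linear functional on univariate polynomials, as a functional on
multivariate polynomials: `x^s ↦ ∏ r (T ^ s i)`. -/
noncomputable def tensorFunctional {A : Type*} [CommRing A] (m : ℕ) (r : Polynomial A →ₗ[A] A) :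
    MvPolynomial (Fin m) A →ₗ[A] A :=
  (basisMonomials (Fin m) A).constr A fun s => ∏ i, r (Polynomial.X ^ s i)

lemma tensorFunctional_prod_aeval {A : Type*} [CommRing A] {m : ℕ} (r : Polynomial A →ₗ[A] A)
    (g : Fin m → Polynomial A) :
    tensorFunctional m r (∏ i, Polynomial.aeval (X i) (g i)) = ∏ i, r (g i) := by
  have h : (tensorFunctional m r).compMultilinearMap
      ((MultilinearMap.mkPiAlgebra A (Fin m) (MvPolynomial (Fin m) A)).compLinearMap
        fun i => (Polynomial.aeval (R := A) (X i : MvPolynomial (Fin m) A)).toLinearMap) =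
      (MultilinearMap.mkPiAlgebra A (Fin m) A).compLinearMap fun _ => r := by
    refine Module.Basis.ext_multilinear (fun _ => Polynomial.basisMonomials A) fun v => ?_
    have h1 : ∏ i, (X i : MvPolynomial (Fin m) A) ^ v i =
        basisMonomials (Fin m) A (Finsupp.equivFunOnFinite.symm v) := by
      simp only [coe_basisMonomials]
      rw [monomial_eq, Finsupp.prod_fintype _ _ (by simp)]
      simp
    simp only [LinearMap.compMultilinearMap_apply, MultilinearMap.compLinearMap_apply,
      MultilinearMap.mkPiAlgebra_apply, Polynomial.coe_basisMonomials, AlgHom.toLinearMap_apply,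
      Polynomial.monomial_one_right_eq_X_pow, map_pow, Polynomial.aeval_X]
    rw [h1, tensorFunctional, Module.Basis.constr_basis]
    rfl
  simpa using congrArg (fun F => F g) h

lemma sum_sign_mul_sum_sign_prod {A : Type*} [CommRing A] {m : ℕ}
    (M : Matrix (Fin m) (Fin m) A) :
    ∑ τ : Equiv.Perm (Fin m), ∑ σ : Equiv.Perm (Fin m),
      ((Equiv.Perm.sign τ : ℤ) : A) * ((Equiv.Perm.sign σ : ℤ) : A) * ∏ l, M (σ l) (τ l) =
      m.factorial * M.det := by
  have h : ∀ τ : Equiv.Perm (Fin m), ∑ σ : Equiv.Perm (Fin m),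
      ((Equiv.Perm.sign τ : ℤ) : A) * ((Equiv.Perm.sign σ : ℤ) : A) * ∏ l, M (σ l) (τ l) =
      M.det := by
    intro τ
    simp_rw [mul_assoc, ← Finset.mul_sum]
    have h1 := Matrix.det_apply' (M.submatrix id τ)
    simp only [Matrix.submatrix_apply, id] at h1
    rw [← h1, Matrix.det_permute', ← mul_assoc, ← Int.cast_mul, ← Units.val_mul,
      Int.units_mul_self]
    simp
  rw [Finset.sum_congr rfl fun τ _ => h τ]
  simp [Fintype.card_perm]

/-- Andréief's identity for the tensor power of a functional. -/
lemma tensorFunctional_det_mul_det {A : Type*} [CommRing A] {m : ℕ} (r : Polynomial A →ₗ[A] A)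
    (g f : Fin m → Polynomial A) :
    tensorFunctional m r
      ((Matrix.of fun i l => Polynomial.aeval (X l : MvPolynomial (Fin m) A) (g i)).det *
        (Matrix.of fun j l => Polynomial.aeval (X l : MvPolynomial (Fin m) A) (f j)).det) =
      m.factorial * (Matrix.of fun i j => r (g i * f j)).det := by
  rw [← sum_sign_mul_sum_sign_prod, Matrix.det_apply', Matrix.det_apply', Finset.sum_mul_sum,
    Finset.sum_comm, map_sum]
  refine Finset.sum_congr rfl fun τ _ => ?_
  rw [map_sum]
  refine Finset.sum_congr rfl fun σ _ => ?_
  have h : ((Equiv.Perm.sign σ : ℤ) : MvPolynomial (Fin m) A) *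
      (∏ l, (Matrix.of fun i l => Polynomial.aeval (X l : MvPolynomial (Fin m) A) (g i)) (σ l) l) *
      (((Equiv.Perm.sign τ : ℤ) : MvPolynomial (Fin m) A) *
      ∏ l, (Matrix.of fun i l => Polynomial.aeval (X l : MvPolynomial (Fin m) A) (f i)) (τ l) l) =
      (((Equiv.Perm.sign τ : ℤ) : A) * ((Equiv.Perm.sign σ : ℤ) : A)) •
        ∏ l, Polynomial.aeval (X l : MvPolynomial (Fin m) A) (g (σ l) * f (τ l)) := by
    simp only [Matrix.of_apply, map_mul, Finset.prod_mul_distrib, smul_eq_C_mul, map_intCast]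
    ring
  rw [h, map_smul, tensorFunctional_prod_aeval, smul_eq_mul]
  rfl

lemma tensorFunctional_aeval_mul_eq_zero {A : Type*} [CommRing A] {m : ℕ}
    (r : Polynomial A →ₗ[A] A) (p : Polynomial A) (hp : ∀ a, r (Polynomial.X ^ a * p) = 0)
    (l : Fin m) (q : MvPolynomial (Fin m) A) :
    tensorFunctional m r (Polynomial.aeval (X l) p * q) = 0 := by
  induction q using MvPolynomial.induction_on' with
  | add q q' hq hq' => rw [mul_add, map_add, hq, hq', add_zero]
  | monomial s a =>
    have h : Polynomial.aeval (X l) p * monomial s a =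
        a • ∏ i, Polynomial.aeval (X i : MvPolynomial (Fin m) A)
          (Polynomial.X ^ s i * if i = l then p else 1) := by
      simp only [map_mul, Finset.prod_mul_distrib, map_pow, Polynomial.aeval_X]
      have h1 : ∏ i, Polynomial.aeval (X i : MvPolynomial (Fin m) A) (if i = l then p else 1) =
          Polynomial.aeval (X l : MvPolynomial (Fin m) A) p := by
        rw [Finset.prod_eq_single l (fun i _ hi => by simp [hi]) (by simp), if_pos rfl]
      rw [h1, monomial_eq, Finsupp.prod_fintype _ _ (by simp), smul_eq_C_mul]
      ring
    rw [h, map_smul, tensorFunctional_prod_aeval,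
      Finset.prod_eq_zero (Finset.mem_univ l) (by rw [if_pos rfl, hp]), smul_zero]

/-- The residue functional `p ↦ Res (p / ∏ (T - b))`, that is `T ^ k ↦ h_{k - N + 1}(𝔹)`. -/
noncomputable def residueFunctional (N : ℕ) :
    Polynomial (MvPolynomial (Fin N) ℂ) →ₗ[MvPolynomial (Fin N) ℂ] MvPolynomial (Fin N) ℂ :=
  (Polynomial.basisMonomials _).constr (MvPolynomial (Fin N) ℂ) fun k =>
    hdiffZ Finset.univ ∅ ((k : ℤ) - N + 1)

lemma residueFunctional_X_pow (N k : ℕ) :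
    residueFunctional N (Polynomial.X ^ k) = hdiffZ Finset.univ ∅ ((k : ℤ) - N + 1) := by
  have h := (Polynomial.basisMonomials (MvPolynomial (Fin N) ℂ)).constr_basis
    (MvPolynomial (Fin N) ℂ) (fun k => hdiffZ (Finset.univ : Finset (Fin N)) ∅ ((k : ℤ) - N + 1)) k
  simp only [Polynomial.coe_basisMonomials, Polynomial.monomial_one_right_eq_X_pow] at h
  exact h

/-- `h_n(T - 𝔹)` as a polynomial in `T`. -/
noncomputable def hdiffPoly (N n : ℕ) : Polynomial (MvPolynomial (Fin N) ℂ) :=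
  ∑ k ∈ Finset.range (n + 1), ((-1) ^ k * esymmF Finset.univ k : MvPolynomial (Fin N) ℂ) •
    Polynomial.X ^ (n - k)

lemma residueFunctional_X_pow_mul_hdiffPoly {N a n : ℕ} (h : a < N ∨ N ≤ n) :
    residueFunctional N (Polynomial.X ^ a * hdiffPoly N n) = if a + n + 1 = N then 1 else 0 := by
  have h1 : residueFunctional N (Polynomial.X ^ a * hdiffPoly N n) =
      hdiffZ Finset.univ Finset.univ ((a : ℤ) + n - N + 1) := by
    rw [hdiffZ_eq_sum _ _ _ n (by rw [Finset.card_univ, Fintype.card_fin]; lia), hdiffPoly,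
      Finset.mul_sum, map_sum]
    refine Finset.sum_congr rfl fun k hk => ?_
    have hk' := Finset.mem_range.1 hk
    rw [mul_smul_comm, map_smul, ← pow_add, residueFunctional_X_pow, smul_eq_mul]
    congr 2
    rw [Nat.cast_add, Nat.cast_sub (by lia)]
    ring
  rw [h1]
  rcases lt_or_ge ((a : ℤ) + n - N + 1) 0 with hneg | hnn
  · rw [hdiffZ_of_neg _ _ hneg, if_neg (by lia)]
  · have h2 : (a : ℤ) + n - N + 1 = ((a + n + 1 - N : ℕ) : ℤ) := by
      rw [Nat.cast_sub (by lia)]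
      push_cast
      ring
    rw [h2, hdiffZ_natCast, hdiff_self]
    congr 1
    apply propext
    lia

lemma sumAlgEquiv_hdiffZ_BS {m N : ℕ} (l : Fin m) (n : ℕ) :
    sumAlgEquiv ℂ (Fin m) (Fin N) (hdiffZ {Sum.inl l} (BS m N) n) =
      Polynomial.aeval (X l) (hdiffPoly N n) := by
  rw [hdiffZ_natCast, hdiff, map_sum, hdiffPoly, map_sum]
  refine Finset.sum_congr rfl fun k _ => ?_
  have h1 : esymmF (BS m N) k = rename Sum.inr (esymmF Finset.univ k) := by
    rw [rename_esymmF Sum.inr_injective]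
    rfl
  rw [← hdiff_empty, ← hdiffZ_natCast, hdiffZ_singleton, h1, map_mul, map_mul, map_pow, map_pow,
    map_neg, map_one, sumAlgEquiv_rename_inr, sumAlgEquiv_X_inl, map_smul, map_pow,
    Polynomial.aeval_X, smul_eq_C_mul]
  simp

lemma sumAlgEquiv_hdiffZ_empty {m N : ℕ} (l : Fin m) (n : ℕ) :
    sumAlgEquiv ℂ (Fin m) (Fin N) (hdiffZ {Sum.inl l} ∅ n) =
      Polynomial.aeval (X l) (Polynomial.X ^ n : Polynomial (MvPolynomial (Fin N) ℂ)) := by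
  rw [hdiffZ_singleton, map_pow, sumAlgEquiv_X_inl, map_pow, Polynomial.aeval_X]

lemma det_ite_eq {R : Type*} [CommRing R] {m : ℕ} (a b : Fin m → ℕ) (ha : StrictAnti a)
    (hb : StrictAnti b) :
    (Matrix.of fun i j => if a i = b j then (1 : R) else 0).det =
      if ∀ i, a i = b i then 1 else 0 := by
  split_ifs with h
  · have h1 : (Matrix.of fun i j => if a i = b j then (1 : R) else 0) = 1 := by
      ext i j
      rw [Matrix.of_apply, ← h j, Matrix.one_apply]
      simp [ha.injective.eq_iff]
    rw [h1, Matrix.det_one]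
  · by_cases hrow : ∀ i, ∃ j, a i = b j
    · refine absurd (fun i => ?_) h
      have h1 : Set.range a ⊆ Set.range b := by
        rintro _ ⟨i, rfl⟩
        obtain ⟨j, hj⟩ := hrow i
        exact ⟨j, hj.symm⟩
      have h2 : Set.range a = Set.range b := by
        refine Set.eq_of_subset_of_ncard_le h1 ?_ (Set.finite_range b)
        rw [← Set.image_univ, ← Set.image_univ, Set.ncard_image_of_injective _ ha.injective,
          Set.ncard_image_of_injective _ hb.injective]
      exact congrFun (Set.range_injOn_strictAnti ha hb h2) i
    · push Not at hrow
      obtain ⟨i, hi⟩ := hrow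
      exact Matrix.det_eq_zero_of_row_eq_zero i fun j => by rw [Matrix.of_apply, if_neg (hi j)]

lemma schurDiff_mul_alternant {m N : ℕ} (B : Finset (Fin m ⊕ Fin N)) (l : Fin m → ℕ) :
    SchurDiff (XS m N) B l * alternant (Sum.inl : Fin m → Fin m ⊕ Fin N) =
      (Matrix.of fun i l' : Fin m => hdiffZ {Sum.inl l'} B ((l i + Fin.rev i : ℕ) : ℤ)).det := by
  rw [det_hdiffZ_singleton Sum.inl_injective B fun i => ((l i + Fin.rev i : ℕ) : ℤ), SchurDiff]
  congr 2
  ext i j : 1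
  rw [Matrix.of_apply, Matrix.of_apply, XS]
  congr 1
  have := i.isLt
  rw [Fin.val_rev]
  lia

lemma schurDiff_zero {σ : Type*} [DecidableEq σ] (A B : Finset σ) (m : ℕ) :
    SchurDiff A B (fun _ : Fin m => 0) = 1 := by
  rw [← det_hdiffZ_unitriangular A B m, SchurDiff]
  congr 2
  ext i j : 2
  congr 1
  simp

lemma hdiff_mul_alternant {k N : ℕ} (t : ℕ) :
    hdiff (XS (k + 1) N) (BS (k + 1) N) t *
        alternant (Sum.inl : Fin (k + 1) → Fin (k + 1) ⊕ Fin N) =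
      (Matrix.of fun i l : Fin (k + 1) => hdiffZ {Sum.inl l} (BS (k + 1) N)
        ((if i = 0 then t + k else Fin.rev i : ℕ) : ℤ)).det := by
  rw [det_hdiffZ_singleton Sum.inl_injective (BS (k + 1) N)
    fun i => ((if i = 0 then t + k else Fin.rev i : ℕ) : ℤ), Matrix.det_of_isUpperTriangular]
  · congr 1
    rw [Fin.prod_univ_succ, Finset.prod_eq_one, mul_one, ← hdiffZ_natCast]
    · simp only [Matrix.of_apply, if_true, XS]
      congr 1
      push_cast
      simp
    · intro i _
      rw [Matrix.of_apply, if_neg (Fin.succ_ne_zero i), ← hdiff_zero (Finset.univ.image Sum.inl)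
        (BS (k + 1) N), ← hdiffZ_natCast]
      congr 1
      have := i.isLt
      rw [Fin.val_rev, Fin.val_succ]
      lia
  · intro i j h
    have h' : (j : ℕ) < i := h
    have hi : i ≠ 0 := by
      rintro rfl
      exact absurd h' (by simp)
    have := i.isLt
    exact hdiffZ_of_neg _ _ (by rw [if_neg hi, Fin.val_rev]; lia)

/-- The Sylvester operator on polynomials, `f ↦ (1 / m!) Res (± f V² / ∏ (x - b))` where `V` is
the Vandermonde determinant in the `x`-variables. -/
noncomputable def sylvesterVal (m N : ℕ) (f : PXB m N) : MvPolynomial (Fin N) ℂ :=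
  C (m.factorial : ℂ)⁻¹ * ((Equiv.Perm.sign (Fin.revPerm (n := m)) : ℤ) : MvPolynomial (Fin N) ℂ) *
    tensorFunctional m (residueFunctional N) (sumAlgEquiv ℂ (Fin m) (Fin N)
      (f * alternant Sum.inl * alternant Sum.inl))

lemma sylvesterVal_zero (m N : ℕ) : sylvesterVal m N 0 = 0 := by
  simp [sylvesterVal]

lemma sylvesterVal_add {m N : ℕ} (f g : PXB m N) :
    sylvesterVal m N (f + g) = sylvesterVal m N f + sylvesterVal m N g := by
  simp only [sylvesterVal, add_mul, map_add, mul_add]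

lemma sylvesterVal_rename_mul {m N : ℕ} (q : MvPolynomial (Fin N) ℂ) (f : PXB m N) :
    sylvesterVal m N (rename Sum.inr q * f) = q * sylvesterVal m N f := by
  rw [sylvesterVal, sylvesterVal, mul_assoc (rename Sum.inr q), mul_assoc (rename Sum.inr q),
    map_mul, sumAlgEquiv_rename_inr, ← smul_eq_C_mul _ q, map_smul, smul_eq_mul]
  ring

lemma sylvesterVal_mul_hdiff {m N : ℕ} (h1 : 1 ≤ m) (u : PXB m N) (t : ℕ) (ht : N + 1 - m ≤ t) :
    sylvesterVal m N (u * hdiff (XS m N) (BS m N) t) = 0 := by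
  obtain ⟨k, rfl⟩ := Nat.exists_eq_add_of_le' h1
  have h : u * hdiff (XS (k + 1) N) (BS (k + 1) N) t * alternant Sum.inl * alternant Sum.inl =
      (hdiff (XS (k + 1) N) (BS (k + 1) N) t * alternant Sum.inl) * (u * alternant Sum.inl) := by
    ring
  rw [sylvesterVal, h, hdiff_mul_alternant, Matrix.det_succ_row_zero, Finset.sum_mul, map_sum,
    map_sum, Finset.sum_eq_zero, mul_zero]
  intro j _
  rw [Matrix.of_apply, if_pos rfl, mul_comm ((-1) ^ (j : ℕ)), mul_assoc, mul_assoc, map_mul,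
    sumAlgEquiv_hdiffZ_BS]
  refine tensorFunctional_aeval_mul_eq_zero _ _ (fun a => ?_) _ _
  rw [residueFunctional_X_pow_mul_hdiffPoly (Or.inr (by lia)), if_neg (by lia)]

lemma sylvesterVal_eq_zero_of_mem {m N : ℕ} (h1 : 1 ≤ m) (p : SymXB m N) (hp : p ∈ HId m N) :
    sylvesterVal m N p = 0 := by
  suffices h : ∀ u : SymXB m N, sylvesterVal m N (u * p) = 0 by simpa using h 1
  induction hp using Submodule.span_induction with
  | mem p hp =>
    obtain ⟨t, ht, -, hpt⟩ := hp
    intro u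
    rw [hpt, sylvesterVal_mul_hdiff h1 _ _ ht]
  | zero => simp [sylvesterVal_zero]
  | add p q _ _ hp hq =>
    intro u
    rw [AddMemClass.coe_add, mul_add, sylvesterVal_add, hp, hq, add_zero]
  | smul c p _ hp =>
    intro u
    have h := hp (u * c)
    rwa [MulMemClass.coe_mul, mul_assoc] at h

lemma sylvesterVal_schurP_mul_schurDiff {m N : ℕ} (h2 : m ≤ N) (lam mu : PartitionIn m (N - m)) :
    sylvesterVal m N (SchurP (XS m N) lam.1 * SchurDiff (XS m N) (BS m N) mu.1) =
      if ∀ j : Fin m, lam.1 j + mu.1 (Fin.rev j) = N - m then 1 else 0 := by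
  have h : SchurP (XS m N) lam.1 * SchurDiff (XS m N) (BS m N) mu.1 * alternant Sum.inl *
      alternant Sum.inl = (SchurDiff (XS m N) ∅ lam.1 * alternant Sum.inl) *
        (SchurDiff (XS m N) (BS m N) mu.1 * alternant Sum.inl) := by
    rw [SchurP]
    ring
  rw [sylvesterVal, h, schurDiff_mul_alternant, schurDiff_mul_alternant, map_mul, AlgEquiv.map_det,
    AlgEquiv.map_det]
  have hl : (sumAlgEquiv ℂ (Fin m) (Fin N)).mapMatrix
      (Matrix.of fun i l' : Fin m => hdiffZ {Sum.inl l'} ∅ ((lam.1 i + Fin.rev i : ℕ) : ℤ)) =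
      Matrix.of fun i l => Polynomial.aeval (X l)
        (Polynomial.X ^ (lam.1 i + Fin.rev i : ℕ) : Polynomial (MvPolynomial (Fin N) ℂ)) := by
    ext i l : 1
    exact sumAlgEquiv_hdiffZ_empty _ _
  have hm : (sumAlgEquiv ℂ (Fin m) (Fin N)).mapMatrix
      (Matrix.of fun i l' : Fin m => hdiffZ {Sum.inl l'} (BS m N) ((mu.1 i + Fin.rev i : ℕ) : ℤ)) =
      Matrix.of fun i l => Polynomial.aeval (X l) (hdiffPoly N (mu.1 i + Fin.rev i : ℕ)) := by
    ext i l : 1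
    exact sumAlgEquiv_hdiffZ_BS _ _
  rw [hl, hm, tensorFunctional_det_mul_det]
  have hdet : ((Equiv.Perm.sign (Fin.revPerm (n := m)) : ℤ) : MvPolynomial (Fin N) ℂ) *
      (Matrix.of fun i j : Fin m => residueFunctional N (Polynomial.X ^ (lam.1 i + Fin.rev i : ℕ) *
        hdiffPoly N (mu.1 j + Fin.rev j : ℕ))).det =
      if ∀ j : Fin m, lam.1 j + mu.1 (Fin.rev j) = N - m then 1 else 0 := by
    have hrev : ∀ i : Fin m, (Fin.rev i : ℕ) + i + 1 = m := fun i => by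
      have := i.isLt
      rw [Fin.val_rev]
      lia
    rw [← Matrix.det_permute']
    have hM : (Matrix.of fun i j : Fin m => residueFunctional N
        (Polynomial.X ^ (lam.1 i + Fin.rev i : ℕ) *
          hdiffPoly N (mu.1 j + Fin.rev j : ℕ))).submatrix id Fin.revPerm =
        Matrix.of fun i j : Fin m =>
          if lam.1 i + Fin.rev i = N - 1 - (mu.1 (Fin.rev j) + j) then 1 else 0 := by
      ext i j : 1
      have hi := hrev i
      have hj := hrev j
      have h3 := lam.2.2 i
      have h4 := mu.2.2 (Fin.rev j)
      rw [Matrix.submatrix_apply, Matrix.of_apply, Matrix.of_apply, id, Fin.revPerm_apply,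
        Fin.rev_rev, residueFunctional_X_pow_mul_hdiffPoly (Or.inl (by lia))]
      congr 1
      apply propext
      lia
    rw [hM, det_ite_eq]
    · congr 1
      apply propext
      refine forall_congr' fun j => ?_
      have hj := hrev j
      have h3 := lam.2.2 j
      have h4 := mu.2.2 (Fin.rev j)
      lia
    · intro i j hij
      have h3 := lam.2.1 hij.le
      have hi := hrev i
      have hj := hrev j
      have : (i : ℕ) < j := hij
      lia
    · intro i j hij
      have h3 := mu.2.1 (Fin.rev_le_rev.2 hij.le)
      have h4 := mu.2.2 (Fin.rev i)
      have h5 := mu.2.2 (Fin.rev j)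
      have hi := hrev i
      have hj := hrev j
      have : (i : ℕ) < j := hij
      dsimp only
      lia
  have hfac : C (m.factorial : ℂ)⁻¹ * (m.factorial : MvPolynomial (Fin N) ℂ) = 1 := by
    rw [← map_natCast (C : ℂ →+* MvPolynomial (Fin N) ℂ), ← map_mul,
      inv_mul_cancel₀ (Nat.cast_ne_zero.2 m.factorial_ne_zero), map_one]
  rw [← hdet, ← one_mul (((Equiv.Perm.sign Fin.revPerm : ℤ) : MvPolynomial (Fin N) ℂ) * _), ← hfac]
  ring

theorem sylvester_operator_exists_unique (h1 : 1 ≤ m) (h2 : m ≤ N)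
    (s t : PartitionIn m (N - m) → ↥(SymXB m N))
    (hs : ∀ l, ((s l : PXB m N)) = SchurP (XS m N) l.1)
    (ht : ∀ l, ((t l : PXB m N)) = SchurDiff (XS m N) (BS m N) l.1) :
    ∃! ζ : (↥(SymXB m N) ⧸ HId m N) →ₗ[↥(SymB m N)] ↥(SymB m N),
      ∀ lam mu : PartitionIn m (N - m),
        ζ (Ideal.Quotient.mk (HId m N) (s lam * t mu)) =
          if ∀ j : Fin m, lam.1 j + mu.1 (Fin.rev j) = N - m then 1 else 0 := by
  have hval : ∀ lam mu, sylvesterVal m N (s lam * t mu : SymXB m N) =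
      if ∀ j : Fin m, lam.1 j + mu.1 (Fin.rev j) = N - m then 1 else 0 := fun lam mu => by
    rw [MulMemClass.coe_mul, hs, ht, sylvesterVal_schurP_mul_schurDiff h2]
  have ht0 : t ⟨fun _ => 0, antitone_const, fun _ => Nat.zero_le _⟩ = 1 :=
    Subtype.ext ((ht _).trans (schurDiff_zero _ _ m))
  have hspan := span_mk_schur_eq_top h2 s hs
  have hwd : ∀ f g : SymXB m N, Ideal.Quotient.mk (HId m N) f = Ideal.Quotient.mk (HId m N) g →
      sylvesterVal m N f = sylvesterVal m N g := by
    intro f g hfg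
    have h := sylvesterVal_eq_zero_of_mem h1 _ (Ideal.Quotient.eq.1 hfg)
    have h3 := sylvesterVal_add ((f - g : SymXB m N) : PXB m N) g
    rwa [h, zero_add, AddSubgroupClass.coe_sub, sub_add_cancel] at h3
  have hex : ∀ z : SymXB m N ⧸ HId m N, ∃ y : SymB m N, ∀ f, Ideal.Quotient.mk (HId m N) f = z →
      ((y : SymXB m N) : PXB m N) = rename Sum.inr (sylvesterVal m N f) := by
    intro z
    have hz : z ∈ Submodule.span (SymB m N)
        (Set.range fun l => Ideal.Quotient.mk (HId m N) (s l)) := by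
      rw [hspan]
      exact Submodule.mem_top
    induction hz using Submodule.span_induction with
    | mem z hz =>
      obtain ⟨l, rfl⟩ := hz
      refine ⟨if ∀ j : Fin m, l.1 j + 0 = N - m then 1 else 0, fun f hf => ?_⟩
      have h := hval l ⟨fun _ => 0, antitone_const, fun _ => Nat.zero_le _⟩
      rw [ht0, mul_one] at h
      rw [hwd f _ hf, h]
      split_ifs <;> simp
    | zero =>
      refine ⟨0, fun f hf => ?_⟩
      rw [sylvesterVal_eq_zero_of_mem h1 f (Ideal.Quotient.eq_zero_iff_mem.1 hf)]
      simp
    | add x y _ _ hx hy =>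
      obtain ⟨a, ha⟩ := hx
      obtain ⟨b, hb⟩ := hy
      obtain ⟨fx, rfl⟩ := Ideal.Quotient.mk_surjective x
      obtain ⟨fy, rfl⟩ := Ideal.Quotient.mk_surjective y
      refine ⟨a + b, fun f hf => ?_⟩
      rw [hwd f (fx + fy) (hf.trans (map_add _ _ _).symm), AddMemClass.coe_add,
        AddMemClass.coe_add, AddMemClass.coe_add, sylvesterVal_add, map_add, ha _ rfl, hb _ rfl]
    | smul c x _ hx =>
      obtain ⟨a, ha⟩ := hx
      obtain ⟨fx, rfl⟩ := Ideal.Quotient.mk_surjective x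
      obtain ⟨q, hq⟩ := c.2
      refine ⟨c * a, fun f hf => ?_⟩
      rw [hwd f ((c : SymXB m N) * fx) hf, MulMemClass.coe_mul, MulMemClass.coe_mul,
        MulMemClass.coe_mul, ha _ rfl, hq, sylvesterVal_rename_mul, map_mul]
  choose ζ hζ using hex
  have hinj : ∀ {a b : SymB m N}, ((a : SymXB m N) : PXB m N) = ((b : SymXB m N) : PXB m N) →
      a = b := fun h => Subtype.ext (Subtype.ext h)
  refine ⟨⟨⟨ζ, fun x y => ?_⟩, fun c x => ?_⟩, fun lam mu => ?_, fun ζ' hζ' => ?_⟩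
  · obtain ⟨fx, rfl⟩ := Ideal.Quotient.mk_surjective x
    obtain ⟨fy, rfl⟩ := Ideal.Quotient.mk_surjective y
    apply hinj
    rw [hζ _ (fx + fy) (map_add _ _ _), AddMemClass.coe_add, AddMemClass.coe_add,
      AddMemClass.coe_add, sylvesterVal_add, map_add, hζ _ _ rfl, hζ _ _ rfl]
  · obtain ⟨fx, rfl⟩ := Ideal.Quotient.mk_surjective x
    obtain ⟨q, hq⟩ := c.2
    apply hinj
    refine (hζ _ ((c : SymXB m N) * fx) rfl).trans ?_
    change _ = ((c * ζ (Ideal.Quotient.mk (HId m N) fx) : SymB m N) : PXB m N)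
    rw [MulMemClass.coe_mul, MulMemClass.coe_mul, MulMemClass.coe_mul, hζ _ _ rfl, hq,
      sylvesterVal_rename_mul, map_mul]
  · apply hinj
    refine (hζ _ _ rfl).trans ?_
    rw [hval]
    split_ifs <;> simp
  · refine LinearMap.ext_on_range hspan fun l => hinj ?_
    have h := hζ' l ⟨fun _ => 0, antitone_const, fun _ => Nat.zero_le _⟩
    rw [ht0, mul_one] at h
    rw [h]
    refine Eq.symm ((hζ _ _ rfl).trans ?_)
    have h := hval l ⟨fun _ => 0, antitone_const, fun _ => Nat.zero_le _⟩
    rw [ht0, mul_one] at h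
    rw [h]
    split_ifs <;> simp
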